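/- Let α ∈ C^1(G, (1/2)ℤ) be such that |∑_{e∈E^𝔬}(α_e γ_e ℓ_e − 𝔪_e γ_e)| ≤ (1/2)·∑_{e∈E^𝔬, α_e ∉ ℤ} ℓ_e |γ_e| for every γ ∈ H^1(G,ℤ). Then there exists f ∈ C^0(G,ℤ) such that for every oriented edge e ∈ 𝔼, either α_e = 𝔡^𝔪_f(e), or 𝔡^𝔪_f(e) ∈ ℤ and |α_e − 𝔡^𝔪_f(e)| = 1/2. -/

import Mathlib

open scoped Classical

/-- A finite loopless multigraph presented by its set of *oriented* edges:
each edge gives rise to two oriented edges, swapped by the fixed-point-free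
involution `rev`. -/
structure OrGraph where
  V : Type
  EO : Type
  fintV : Fintype V
  fintEO : Fintype EO
  decV : DecidableEq V
  decEO : DecidableEq EO
  rev : EO → EO
  tail : EO → V
  head : EO → V
  rev_rev : ∀ e, rev (rev e) = e
  rev_ne : ∀ e, rev e ≠ e
  head_rev : ∀ e, head (rev e) = tail e
  tail_rev : ∀ e, tail (rev e) = head e

attribute [instance] OrGraph.fintV OrGraph.fintEO OrGraph.decV OrGraph.decEO

namespace OrGraph

variable (G : OrGraph)

/-- Adjacency: there is an oriented edge from `u` to `v`. -/
def Adj (u v : G.V) : Prop := ∃ e, G.tail e = u ∧ G.head e = v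

/-- The graph is connected. -/
def Connected : Prop := ∀ u v : G.V, Relation.ReflTransGen G.Adj u v

/-- `g : 𝔼 → A` is a 1-cochain, i.e. `g(ē) = -g(e)`. -/
def IsC1 {A : Type} [Neg A] (g : G.EO → A) : Prop := ∀ e, g (G.rev e) = - g e

/-- The differential `d : C^0(G,A) → C^1(G,A)`, `d(f)(uv) = f(v) - f(u)`. -/
def d {A : Type} [Sub A] (f : G.V → A) : G.EO → A :=
  fun e => f (G.head e) - f (G.tail e)

/-- The adjoint `d* : C^1(G,A) → C^0(G,A)`, `d*(g)(v) = ∑_{head e = v} g(e)`. -/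
def dstar {A : Type} [AddCommMonoid A] (g : G.EO → A) : G.V → A :=
  fun v => ∑ e ∈ Finset.univ.filter (fun e => G.head e = v), g e

/-- The 1-cochain `χ_e - χ_ē`: value `1` at `e`, `-1` at `ē`, `0` elsewhere. -/
def chi (A : Type) [Zero A] [One A] [Neg A] (e : G.EO) : G.EO → A :=
  fun f => if f = e then 1 else if f = G.rev e then -1 else 0

/-- The set `S ⊆ V` induces a connected subgraph. -/
def ConnectedOn (S : Set G.V) : Prop :=
  ∀ u ∈ S, ∀ v ∈ S,
    Relation.ReflTransGen (fun a b => a ∈ S ∧ b ∈ S ∧ G.Adj a b) u v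

/-- `β` is a bond element: `β = d(χ_X)` with `X` nonempty, proper, and both
`G[X]` and `G[V-X]` connected. -/
def IsBond (β : G.EO → ℝ) : Prop :=
  ∃ X : Finset G.V, X.Nonempty ∧ Xᶜ.Nonempty ∧
    G.ConnectedOn ↑X ∧ G.ConnectedOn ↑(Xᶜ) ∧
    β = G.d (fun v => if v ∈ X then (1 : ℝ) else 0)

/-- The positive support of a real 1-cochain. -/
def suppPlus (x : G.EO → ℝ) : Set G.EO := {e | 0 < x e}

/-- The cone generated by a set of vectors: all finite nonnegative combinations. -/
def coneGen (S : Set (G.EO → ℝ)) : Set (G.EO → ℝ) :=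
  { x | ∃ (t : Finset (G.EO → ℝ)) (c : (G.EO → ℝ) → ℝ),
      (∀ y ∈ t, y ∈ S) ∧ (∀ y ∈ t, 0 ≤ c y) ∧ x = ∑ y ∈ t, c y • y }

/-- `D ⊆ 𝔼` is a coherent acyclic orientation of a cut subgraph of `G`:
for some ordered partition of `V` (encoded by `r : V → ℕ`), `D` consists of
the oriented edges going from a smaller part to a bigger part. -/
def IsCAC (D : Set G.EO) : Prop :=
  ∃ r : G.V → ℕ, D = {e | r (G.tail e) < r (G.head e)}

/-- The cone `σ_D` generated by the bond elements with positive support in `D`. -/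
def bondCone (D : Set G.EO) : Set (G.EO → ℝ) :=
  G.coneGen {β | G.IsBond β ∧ G.suppPlus β ⊆ D}

/-- The cone `σ_{𝔼(D)}` generated by the `χ_e - χ_ē` for `e ∈ D`. -/
def edgeCone (D : Set G.EO) : Set (G.EO → ℝ) :=
  G.coneGen {x | ∃ e ∈ D, x = G.chi ℝ e}

/-- The cut space `F_ℝ`, the image of `d : C^0(G,ℝ) → C^1(G,ℝ)`. -/
def cutSpace : Set (G.EO → ℝ) := {x | ∃ f : G.V → ℝ, x = G.d f}

/-- `γ` is an oriented cycle: a nonempty cyclic sequence of oriented edges with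
pairwise distinct underlying edges, the head of each being the tail of the next. -/
def IsCycle (γ : List G.EO) : Prop :=
  γ ≠ [] ∧
  (∀ i : Fin γ.length,
    G.head (γ.get i) = G.tail (γ.get ⟨((i : ℕ) + 1) % γ.length, Nat.mod_lt _ i.pos⟩)) ∧
  (∀ i j : Fin γ.length, i ≠ j → γ.get i ≠ γ.get j ∧ γ.get i ≠ G.rev (γ.get j))

/-- `δ^{𝔪,n}_e(f) = ⌊(f(head e) - f(tail e) + n 𝔪_e)/(n ℓ_e)⌋`. -/
def ddelta (ℓ : G.EO → ℕ) (m : G.EO → ℤ) (n : ℕ) (f : G.V → ℤ) (e : G.EO) : ℤ :=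
  ⌊((f (G.head e) : ℚ) - (f (G.tail e) : ℚ) + (n : ℚ) * (m e : ℚ)) /
    ((n : ℚ) * (ℓ e : ℚ))⌋

/-- `𝔡^{𝔪,n}_f(e) = (δ^{𝔪,n}_e(f) - δ^{𝔪,n}_{ē}(f))/2`. -/
def dd (ℓ : G.EO → ℕ) (m : G.EO → ℤ) (n : ℕ) (f : G.V → ℤ) (e : G.EO) : ℚ :=
  ((G.ddelta ℓ m n f e : ℚ) - (G.ddelta ℓ m n f (G.rev e) : ℚ)) / 2

end OrGraph

namespace OrGraph

/-- `G.WalkCount u v c`: some walk from `u` to `v` traverses each oriented edge `e` exactly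
`c e` times. -/
inductive WalkCount (G : OrGraph) (u : G.V) : G.V → (G.EO → ℤ) → Prop
  | nil : WalkCount G u u 0
  | snoc (e : G.EO) (c : G.EO → ℤ) (h : WalkCount G u (G.tail e) c) :
      WalkCount G u (G.head e) (c + Pi.single e 1)

namespace WalkCount

variable {G : OrGraph}

theorem trans {u v x : G.V} {c c' : G.EO → ℤ} (h : G.WalkCount u v c)
    (h' : G.WalkCount v x c') : G.WalkCount u x (c + c') := by
  induction h' with
  | nil => simpa using h
  | snoc e c' _ ih => simpa [add_assoc] using WalkCount.snoc e _ ih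

theorem nonneg {u v : G.V} {c : G.EO → ℤ} (h : G.WalkCount u v c) : 0 ≤ c := by
  induction h with
  | nil => exact le_rfl
  | snoc e c _ ih => exact add_nonneg ih (Pi.single_nonneg.2 zero_le_one)

theorem net_flow {u v : G.V} {c : G.EO → ℤ} (h : G.WalkCount u v c) (x : G.V) :
    ∑ e, (if G.head e = x then c e else 0) - ∑ e, (if G.tail e = x then c e else 0) =
      (if v = x then 1 else 0) - (if u = x then 1 else 0) := by
  induction h with
  | nil => simp
  | snoc e c _ ih =>
    have key (p : G.EO → G.V) : ∑ a, (if p a = x then (c + Pi.single e 1 : G.EO → ℤ) a else 0) =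
        ∑ a, (if p a = x then c a else 0) + if p e = x then 1 else 0 := by
      have (a : G.EO) : (if p a = x then (c + Pi.single e 1 : G.EO → ℤ) a else 0) =
          (if p a = x then c a else 0) + if a = e then (if p e = x then 1 else 0) else 0 := by
        by_cases hae : a = e
        · subst hae
          by_cases hp : p a = x <;> simp [hp]
        · simp [hae]
      simp only [this, Finset.sum_add_distrib, Finset.sum_ite_eq', Finset.mem_univ, if_true]
    rw [key, key]
    linarith

end WalkCount

variable (G : OrGraph)

theorem Connected.exists_walkCount {G : OrGraph} (hG : G.Connected) (u v : G.V) :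
    ∃ c, G.WalkCount u v c := by
  induction hG u v with
  | refl => exact ⟨0, .nil⟩
  | tail _ hadj ih =>
    obtain ⟨c, hc⟩ := ih
    obtain ⟨e, rfl, rfl⟩ := hadj
    exact ⟨_, .snoc e c hc⟩

/-- In the absence of closed walks of negative weight there is an integral feasible potential. -/
theorem exists_potential (hG : G.Connected) (w : G.EO → ℤ)
    (hw : ∀ u c, G.WalkCount u u c → 0 ≤ ∑ e, c e * w e) :
    ∃ f : G.V → ℤ, ∀ e, f (G.head e) ≤ f (G.tail e) + w e := by
  rcases isEmpty_or_nonempty G.V with hV | ⟨⟨r⟩⟩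
  · exact ⟨0, fun e => hV.elim (G.head e)⟩
  let S : G.V → Set ℤ := fun v => {x | ∃ c, G.WalkCount r v c ∧ x = ∑ e, c e * w e}
  have hne (v : G.V) : (S v).Nonempty := by
    obtain ⟨c, hc⟩ := hG.exists_walkCount r v
    exact ⟨_, c, hc, rfl⟩
  have hbdd (v : G.V) : BddBelow (S v) := by
    obtain ⟨c', hc'⟩ := hG.exists_walkCount v r
    refine ⟨-∑ e, c' e * w e, ?_⟩
    rintro _ ⟨c, hc, rfl⟩
    have := hw r _ (hc.trans hc')
    simp only [Pi.add_apply, add_mul, Finset.sum_add_distrib] at this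
    linarith
  refine ⟨fun v => sInf (S v), fun e => ?_⟩
  obtain ⟨c, hc, hx⟩ := Int.csInf_mem (hne (G.tail e)) (hbdd _)
  refine csInf_le (hbdd _) ⟨_, hc.snoc e, ?_⟩
  simp [add_mul, Finset.sum_add_distrib, hx, Pi.single_apply]

theorem sum_eq_sum_orientation {A : Type} [AddCommMonoid A] {O : Finset G.EO}
    (hO : ∀ e, e ∈ O ↔ G.rev e ∉ O) (g : G.EO → A) :
    ∑ e, g e = ∑ e ∈ O, (g e + g (G.rev e)) := by
  rw [Finset.sum_add_distrib, ← Finset.sum_add_sum_compl O]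
  congr 1
  refine Finset.sum_nbij' G.rev G.rev ?_ ?_ ?_ ?_ ?_
  · intro e he
    rw [hO, G.rev_rev]
    simpa using he
  · intro e he
    simpa using (hO e).1 he
  · exact fun e _ => G.rev_rev e
  · exact fun e _ => G.rev_rev e
  · exact fun e _ => by rw [G.rev_rev]

theorem WalkCount.dstar_eq_zero {G : OrGraph} {u : G.V} {c : G.EO → ℤ}
    (h : G.WalkCount u u c) : G.dstar (fun e => c e - c (G.rev e)) = 0 := by
  funext x
  have hflow := h.net_flow x
  have hrev : ∑ e, (if G.tail e = x then c e else 0) =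
      ∑ e, (if G.head e = x then c (G.rev e) else 0) :=
    Finset.sum_nbij' G.rev G.rev (by simp) (by simp) (fun e _ => G.rev_rev e)
      (fun e _ => G.rev_rev e) (fun e _ => by rw [G.head_rev, G.rev_rev])
  rw [hrev, sub_self] at hflow
  simpa [dstar, Finset.sum_filter, Finset.sum_sub_distrib] using hflow

end OrGraph

/-- A rational between consecutive integers `k` and `k + 1` has symmetrized floor `k`, `k + 1/2`
or `k + 1`. -/
theorem symm_floor_of_mem_Icc {q : ℚ} {k : ℤ} (h₁ : (k : ℚ) ≤ q) (h₂ : q ≤ k + 1) :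
    ((⌊q⌋ : ℚ) - ⌊-q⌋) / 2 = k ∨ ((⌊q⌋ : ℚ) - ⌊-q⌋) / 2 = k + 1 / 2 ∨
      ((⌊q⌋ : ℚ) - ⌊-q⌋) / 2 = k + 1 := by
  rcases h₁.eq_or_lt with rfl | h₁
  · left
    rw [← Int.cast_neg, Int.floor_intCast, Int.floor_intCast]
    push_cast
    ring
  rcases h₂.eq_or_lt with rfl | h₂
  · right; right
    have : ((k : ℚ) + 1) = ((k + 1 : ℤ) : ℚ) := by push_cast; rfl
    rw [this, ← Int.cast_neg, Int.floor_intCast, Int.floor_intCast]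
    push_cast
    ring
  · right; left
    have e₁ : ⌊q⌋ = k := Int.floor_eq_iff.2 ⟨h₁.le, h₂⟩
    have e₂ : ⌊-q⌋ = -(k + 1) :=
      Int.floor_eq_iff.2 ⟨by push_cast; linarith, by push_cast; linarith⟩
    rw [e₁, e₂]
    push_cast
    ring

/-- a half-integral `α` satisfying the displayed inequalities is,
up to `1/2` at non-integral slots, of the form `𝔡^𝔪_f`. -/
theorem alpha_close_to_dd (G : OrGraph) (hconn : G.Connected)
    (ℓ : G.EO → ℕ) (hℓpos : ∀ e, 0 < ℓ e) (hℓsym : ∀ e, ℓ (G.rev e) = ℓ e)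
    (m : G.EO → ℤ) (hm : G.IsC1 m)
    (O : Finset G.EO) (hO : ∀ e, e ∈ O ↔ G.rev e ∉ O)
    (α : G.EO → ℚ) (hα : G.IsC1 α) (hhalf : ∀ e, ∃ z : ℤ, α e = (z : ℚ) / 2)
    (hyp : ∀ γ : G.EO → ℤ, G.IsC1 γ → G.dstar γ = 0 →
      |∑ e ∈ O, (α e * (γ e : ℚ) * (ℓ e : ℚ) - (m e : ℚ) * (γ e : ℚ))| ≤
        (1 / 2) * ∑ e ∈ O,
          (if ∃ z : ℤ, α e = (z : ℚ) then 0 else (ℓ e : ℚ) * |(γ e : ℚ)|)) :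
    ∃ f : G.V → ℤ, ∀ e : G.EO,
      α e = G.dd ℓ m 1 f e ∨
      ((∃ z : ℤ, G.dd ℓ m 1 f e = (z : ℚ)) ∧ |α e - G.dd ℓ m 1 f e| = 1 / 2) := by
  let h : G.EO → ℚ := fun e => if ∃ z : ℤ, α e = (z : ℚ) then 0 else (ℓ e : ℚ) / 2
  have h_nonneg (e : G.EO) : 0 ≤ h e := by
    simp only [h]
    split_ifs <;> positivity
  have h_rev (e : G.EO) : h (G.rev e) = h e := by
    have : (∃ z : ℤ, α (G.rev e) = (z : ℚ)) ↔ ∃ z : ℤ, α e = (z : ℚ) := by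
      rw [hα e]
      constructor
      · rintro ⟨z, hz⟩
        exact ⟨-z, by push_cast; linarith⟩
      · rintro ⟨z, hz⟩
        exact ⟨-z, by push_cast; linarith⟩
    simp only [h, this, hℓsym e]
  have half_odd (e : G.EO) (he : ¬∃ z : ℤ, α e = (z : ℚ)) :
      ∃ k : ℤ, α e = (k : ℚ) + 1 / 2 := by
    obtain ⟨z, hz⟩ := hhalf e
    obtain ⟨k, rfl | rfl⟩ := Int.even_or_odd' z
    · exact absurd ⟨k, by rw [hz]; push_cast; ring⟩ he
    · exact ⟨k, by rw [hz]; push_cast; ring⟩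
  have exists_weight (e : G.EO) : ∃ w : ℤ, (w : ℚ) = α e * ℓ e - m e + h e := by
    by_cases he : ∃ z : ℤ, α e = (z : ℚ)
    · simp only [h, if_pos he]
      obtain ⟨z, hz⟩ := he
      exact ⟨z * ℓ e - m e, by rw [hz]; push_cast; ring⟩
    · simp only [h, if_neg he]
      obtain ⟨k, hk⟩ := half_odd e he
      exact ⟨(k + 1) * ℓ e - m e, by rw [hk]; push_cast; ring⟩
  choose w hw using exists_weight
  have closed_nonneg (u : G.V) (c : G.EO → ℤ) (hc : G.WalkCount u u c) :
      0 ≤ ∑ e, c e * w e := by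
    have hγ := hyp (fun e => c e - c (G.rev e))
      (fun e => by simp only [G.rev_rev]; ring) hc.dstar_eq_zero
    have hlow := (abs_le.1 hγ).1
    rw [Finset.mul_sum] at hlow
    rw [← Int.cast_nonneg_iff (R := ℚ), G.sum_eq_sum_orientation hO]
    push_cast
    have hterm : ∀ e ∈ O, (α e * ((c e - c (G.rev e) : ℤ) : ℚ) * (ℓ e : ℚ) -
          (m e : ℚ) * ((c e - c (G.rev e) : ℤ) : ℚ)) +
        1 / 2 * (if ∃ z : ℤ, α e = (z : ℚ) then 0
          else (ℓ e : ℚ) * |((c e - c (G.rev e) : ℤ) : ℚ)|) ≤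
        (c e : ℚ) * w e + (c (G.rev e) : ℚ) * w (G.rev e) := by
      intro e _
      have h0 : (0 : ℚ) ≤ c e := by exact_mod_cast hc.nonneg e
      have h1 : (0 : ℚ) ≤ c (G.rev e) := by exact_mod_cast hc.nonneg (G.rev e)
      have habs : |((c e - c (G.rev e) : ℤ) : ℚ)| ≤ c e + c (G.rev e) := by
        push_cast
        exact abs_le.2 ⟨by linarith, by linarith⟩
      have hif : 1 / 2 * (if ∃ z : ℤ, α e = (z : ℚ) then 0
          else (ℓ e : ℚ) * |((c e - c (G.rev e) : ℤ) : ℚ)|) =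
          h e * |((c e - c (G.rev e) : ℤ) : ℚ)| := by
        simp only [h]
        split_ifs <;> ring
      have hmul := mul_le_mul_of_nonneg_left habs (h_nonneg e)
      rw [hif, hw, hw, h_rev, hα e, hm e, hℓsym e]
      push_cast at hmul ⊢
      linarith
    have hsum := Finset.sum_le_sum hterm
    rw [Finset.sum_add_distrib] at hsum
    linarith
  obtain ⟨f, hf⟩ := G.exists_potential hconn w closed_nonneg
  refine ⟨f, fun e => ?_⟩
  have hℓ : (0 : ℚ) < ℓ e := by exact_mod_cast hℓpos e
  have hup : (f (G.head e) : ℚ) ≤ f (G.tail e) + w e := by exact_mod_cast hf e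
  have hlow : (f (G.tail e) : ℚ) ≤ f (G.head e) + w (G.rev e) := by
    have := hf (G.rev e)
    rw [G.head_rev, G.tail_rev] at this
    exact_mod_cast this
  rw [hw] at hup hlow
  rw [h_rev, hα e, hm e, hℓsym e] at hlow
  push_cast at hlow
  let q : ℚ := ((f (G.head e) : ℚ) - f (G.tail e) + m e) / ℓ e
  have hdd : G.dd ℓ m 1 f e = ((⌊q⌋ : ℚ) - ⌊-q⌋) / 2 := by
    have hneg : ((f (G.tail e) : ℚ) - f (G.head e) + -m e) / ℓ e = -q := by
      simp only [q]
      ring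
    simp only [OrGraph.dd, OrGraph.ddelta, G.head_rev, G.tail_rev, hm e, hℓsym e,
      Nat.cast_one, one_mul, Int.cast_neg, hneg, q]
  rw [hdd]
  by_cases he : ∃ z : ℤ, α e = (z : ℚ)
  · simp only [h, if_pos he] at hup hlow
    obtain ⟨z, hz⟩ := he
    have hq : q = z := by
      rw [div_eq_iff hℓ.ne', ← hz]
      linarith
    left
    rw [hq, ← Int.cast_neg, Int.floor_intCast, Int.floor_intCast, hz]
    push_cast
    ring
  · simp only [h, if_neg he] at hup hlow
    obtain ⟨k, hk⟩ := half_odd e he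
    rw [hk] at hup hlow ⊢
    have h₁ : (k : ℚ) ≤ q := by
      rw [le_div_iff₀ hℓ]
      linarith
    have h₂ : q ≤ k + 1 := by
      rw [div_le_iff₀ hℓ]
      linarith
    rcases symm_floor_of_mem_Icc h₁ h₂ with hq | hq | hq
    · right
      rw [hq]
      exact ⟨⟨k, rfl⟩, by norm_num⟩
    · left
      rw [hq]
    · right
      rw [hq]
      exact ⟨⟨k + 1, by push_cast; rfl⟩, by
        rw [add_sub_add_left_eq_sub]; norm_num [abs_of_neg]⟩
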